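/- Let ψ ∈ ℂ[X] be a polynomial with deg ψ ≥ 2 and ψ(0) = 0, let λ be the coefficient of X in ψ (that is, λ = ψ'(0)), and for q ≥ 1 let a_q denote the multiplicity of 0 as a root of the polynomial ψ^{∘q}(X) − X. Then for every q ≥ 2: (i) if λ^q ≠ 1 then a_q = a_1 = 1; (ii) if λ ≠ 1 and λ^q = 1 then a_q > a_1 = 1; (iii) if λ = 1 then a_q = a_1 ≥ 2. -/

import Mathlib

/-- The `q`-fold composition `ψ^{∘q}` of a polynomial with itself
(`compIter ψ 0 = X`). -/
noncomputable def compIter (ψ : Polynomial ℂ) : ℕ → Polynomial ℂ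
  | 0 => Polynomial.X
  | n + 1 => ψ.comp (compIter ψ n)

namespace Polynomial

/-- The multiplicity of `0` as a root of `X ^ m * h` is `m` when `h` does not vanish at `0`. -/
theorem rootMultiplicity_zero_X_pow_mul {R : Type*} [CommRing R] [IsDomain R] {m : ℕ} {h : R[X]}
    (hh : h.eval 0 ≠ 0) : rootMultiplicity 0 (X ^ m * h) = m := by
  have hne : h ≠ 0 := by
    rintro rfl
    simp at hh
  have key := rootMultiplicity_mul_X_sub_C_pow (a := (0 : R)) (n := m) hne
  rwa [map_zero, sub_zero, rootMultiplicity_eq_zero hh, zero_add, mul_comm] at key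

end Polynomial

open Polynomial in
/-- Iterates of `X * g` are of the form `X * h` with `h(0) = g(0) ^ n`. -/
theorem exists_compIter_X_mul (g : Polynomial ℂ) (n : ℕ) :
    ∃ h : Polynomial ℂ, compIter (X * g) n = X * h ∧ h.eval 0 = g.eval 0 ^ n := by
  induction n with
  | zero => exact ⟨1, by simp [compIter], by simp⟩
  | succ n ih =>
    obtain ⟨h, hf, hh⟩ := ih
    refine ⟨h * g.comp (X * h), ?_, ?_⟩
    · rw [compIter, hf, mul_comp, X_comp, mul_assoc]
    · simp [eval_comp, hh, pow_succ]

open Polynomial in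
/-- Iterates of `X + X ^ m * g`, where `m ≥ 2`, are of the form `X + X ^ m * h` with
`h(0) = n * g(0)`. -/
theorem exists_compIter_X_add_X_pow_mul {m : ℕ} (hm : 2 ≤ m) (g : Polynomial ℂ) (n : ℕ) :
    ∃ h : Polynomial ℂ, compIter (X + X ^ m * g) n = X + X ^ m * h ∧
      h.eval 0 = n * g.eval 0 := by
  induction n with
  | zero => exact ⟨0, by simp [compIter], by simp⟩
  | succ n ih =>
    obtain ⟨h, hf, hh⟩ := ih
    have hfac : X + X ^ m * h = X * (1 + X ^ (m - 1) * h) := by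
      rw [mul_add, mul_one, ← mul_assoc, mul_pow_sub_one (by omega)]
    refine ⟨h + (1 + X ^ (m - 1) * h) ^ m * g.comp (X + X ^ m * h), ?_, ?_⟩
    · have hpow : (X + X ^ m * h) ^ m = X ^ m * (1 + X ^ (m - 1) * h) ^ m := by
        rw [hfac, mul_pow]
      rw [compIter, hf, add_comp, mul_comp, X_pow_comp, X_comp, hpow]
      ring
    · have h1 : m - 1 ≠ 0 := by omega
      have h2 : m ≠ 0 := by omega
      simp [eval_comp, hh, h1, h2]
      ring

/-- The degree of an iterate is the corresponding power of the degree. -/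
theorem natDegree_compIter (ψ : Polynomial ℂ) (n : ℕ) :
    (compIter ψ n).natDegree = ψ.natDegree ^ n := by
  induction n with
  | zero => simp [compIter]
  | succ n ih => rw [compIter, Polynomial.natDegree_comp, ih, pow_succ']

open Polynomial in
/-- A nontrivial iterate of a polynomial of degree at least `2` is not the identity. -/
theorem compIter_sub_X_ne_zero {ψ : Polynomial ℂ} (hdeg : 2 ≤ ψ.natDegree) {n : ℕ} (hn : n ≠ 0) :
    compIter ψ n - X ≠ 0 := by
  intro h
  have hd := natDegree_compIter ψ n
  rw [sub_eq_zero.mp h, natDegree_X] at hd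
  have := Nat.le_self_pow hn ψ.natDegree
  omega

open Polynomial in
/-- If the multiplier satisfies `λ ^ n ≠ 1`, then `0` is a simple root of `ψ^{∘n}(X) - X`. -/
theorem rootMultiplicity_compIter_sub_X_eq_one {ψ : Polynomial ℂ} (h0 : ψ.eval 0 = 0) {n : ℕ}
    (hn : ψ.coeff 1 ^ n ≠ 1) : rootMultiplicity 0 (compIter ψ n - X) = 1 := by
  obtain ⟨g, rfl⟩ := X_dvd_iff.mpr (ψ.coeff_zero_eq_eval_zero.trans h0)
  rw [coeff_X_mul, coeff_zero_eq_eval_zero] at hn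
  obtain ⟨h, hf, hh⟩ := exists_compIter_X_mul g n
  have hfac : compIter (X * g) n - X = X ^ 1 * (h - 1) := by rw [hf]; ring
  rw [hfac]
  apply rootMultiplicity_zero_X_pow_mul
  rwa [eval_sub, hh, eval_one, sub_ne_zero]

open Polynomial in
/-- If the multiplier satisfies `λ ^ n = 1`, then `0` is a multiple root of `ψ^{∘n}(X) - X`. -/
theorem two_le_rootMultiplicity_compIter_sub_X {ψ : Polynomial ℂ} (hdeg : 2 ≤ ψ.natDegree)
    (h0 : ψ.eval 0 = 0) {n : ℕ} (hn0 : n ≠ 0) (hn : ψ.coeff 1 ^ n = 1) :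
    2 ≤ rootMultiplicity 0 (compIter ψ n - X) := by
  rw [le_rootMultiplicity_iff (compIter_sub_X_ne_zero hdeg hn0), map_zero, sub_zero]
  obtain ⟨g, rfl⟩ := X_dvd_iff.mpr (ψ.coeff_zero_eq_eval_zero.trans h0)
  rw [coeff_X_mul, coeff_zero_eq_eval_zero] at hn
  obtain ⟨h, hf, hh⟩ := exists_compIter_X_mul g n
  have hfac : compIter (X * g) n - X = X * (h - 1) := by rw [hf]; ring
  rw [hfac, pow_two]
  apply mul_dvd_mul_left
  rw [X_dvd_iff, coeff_zero_eq_eval_zero, eval_sub, hh, hn, eval_one, sub_self]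

open Polynomial in
/-- If `ψ(X) - X` vanishes to order at least `2` at `0`, all nontrivial iterates of `ψ` are tangent
to the identity to the same order. -/
theorem rootMultiplicity_compIter_sub_X_eq {ψ : Polynomial ℂ} (hne : ψ - X ≠ 0)
    (hm : 2 ≤ rootMultiplicity 0 (ψ - X)) {n : ℕ} (hn : n ≠ 0) :
    rootMultiplicity 0 (compIter ψ n - X) = rootMultiplicity 0 (ψ - X) := by
  obtain ⟨g, hg, hndvd⟩ := exists_eq_pow_rootMultiplicity_mul_and_not_dvd (ψ - X) hne 0
  generalize rootMultiplicity 0 (ψ - X) = m at hm hg ⊢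
  rw [map_zero, sub_zero] at hg hndvd
  rw [X_dvd_iff, coeff_zero_eq_eval_zero] at hndvd
  obtain rfl : ψ = X + X ^ m * g := by rw [← hg]; ring
  obtain ⟨h, hf, hh⟩ := exists_compIter_X_add_X_pow_mul hm g n
  rw [hf, add_sub_cancel_left]
  apply rootMultiplicity_zero_X_pow_mul
  rw [hh]
  exact mul_ne_zero (Nat.cast_ne_zero.mpr hn) hndvd

/-- **Valuations of `ψ^{∘q}(X) - X` at a fixed point.**
Let `ψ` be a polynomial of degree `≥ 2` with `ψ(0) = 0`, let `λ = ψ'(0)` be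
the multiplier (the coefficient of `X`), and let `a_q` be the multiplicity of
`0` as a root of `ψ^{∘q}(X) - X`. For `q ≥ 2`:
(i) if `λ^q ≠ 1` then `a_q = a_1 = 1`;
(ii) if `λ ≠ 1` and `λ^q = 1` then `a_q > a_1 = 1`;
(iii) if `λ = 1` then `a_q = a_1 ≥ 2`. -/
theorem rootMultiplicity_iterate_sub_X (ψ : Polynomial ℂ)
    (hdeg : 2 ≤ ψ.natDegree) (h0 : ψ.eval 0 = 0) (q : ℕ) (hq : 2 ≤ q) :
    (ψ.coeff 1 ^ q ≠ 1 →
      Polynomial.rootMultiplicity (0 : ℂ) (compIter ψ q - Polynomial.X) = 1 ∧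
      Polynomial.rootMultiplicity (0 : ℂ) (compIter ψ 1 - Polynomial.X) = 1) ∧
    (ψ.coeff 1 ≠ 1 → ψ.coeff 1 ^ q = 1 →
      Polynomial.rootMultiplicity (0 : ℂ) (compIter ψ 1 - Polynomial.X) = 1 ∧
      Polynomial.rootMultiplicity (0 : ℂ) (compIter ψ 1 - Polynomial.X) <
        Polynomial.rootMultiplicity (0 : ℂ) (compIter ψ q - Polynomial.X)) ∧
    (ψ.coeff 1 = 1 →
      Polynomial.rootMultiplicity (0 : ℂ) (compIter ψ q - Polynomial.X) =
        Polynomial.rootMultiplicity (0 : ℂ) (compIter ψ 1 - Polynomial.X) ∧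
      2 ≤ Polynomial.rootMultiplicity (0 : ℂ) (compIter ψ 1 - Polynomial.X)) := by
  have hq0 : q ≠ 0 := by omega
  have hsimple (hl : ψ.coeff 1 ≠ 1) :
      Polynomial.rootMultiplicity (0 : ℂ) (compIter ψ 1 - Polynomial.X) = 1 :=
    rootMultiplicity_compIter_sub_X_eq_one h0 (by rwa [pow_one])
  refine ⟨fun hl => ⟨rootMultiplicity_compIter_sub_X_eq_one h0 hl, hsimple ?_⟩,
    fun hl hlq => ⟨hsimple hl, ?_⟩, fun hl => ?_⟩
  · rintro h
    exact hl (by rw [h, one_pow])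
  · rw [hsimple hl]
    exact two_le_rootMultiplicity_compIter_sub_X hdeg h0 hq0 hlq
  · have htwo := two_le_rootMultiplicity_compIter_sub_X hdeg h0 one_ne_zero (by rw [hl, one_pow])
    have hne := compIter_sub_X_ne_zero hdeg one_ne_zero
    have hone : compIter ψ 1 = ψ := by simp [compIter]
    rw [hone] at htwo hne ⊢
    exact ⟨rootMultiplicity_compIter_sub_X_eq hne htwo hq0, htwo⟩
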